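/- In the plausible-deniability mechanism setup, let t be an integer with 1 ≤ t < k, let ε = ε₀ + ln(1 + γ/t), let D ⊆ U be a finite dataset with |D| ≥ k, let d' ∈ U with d' ∉ D, and let D' = D ∪ {d'}. For y ∈ U define δ(D', d', y) = exp(-ε₀·(k - t)) · (1/|D'|) · Σ_{s ∈ C_{I_{d'}(y)}(D', y)} p s y if p d' y > 0, and δ(D', d', y) = 0 if p d' y = 0. Then for every synthetic record y ∈ U: PF(D', y) ≤ exp(ε) · PF(D, y) + δ(D', d', y). -/

import Mathlib

open Finset

attribute [local instance] Classical.propDecidable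

noncomputable section PD

variable {U : Type*}

/-- Partition number: the unique `i : ℕ` with `γ^{-(i+1)} < x ≤ γ^{-i}` (for `0 < x ≤ 1`),
    given by `⌊-log_γ x⌋`. -/
def Ipart (γ x : ℝ) : ℕ := ⌊-Real.logb γ x⌋₊

/-- Partition set `C_i(D, y) = {d ∈ D : p d y > 0 ∧ I_d(y) = i}`. -/
def Cpart (p : U → U → ℝ) (γ : ℝ) (D : Finset U) (y : U) (i : ℕ) : Finset U :=
  D.filter fun d => 0 < p d y ∧ Ipart γ (p d y) = i

/-- Laplace upper-tail function `Pr[L ≥ x]` for `L ~ Lap(1/ε₀)`. -/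
def lapTail (ε₀ x : ℝ) : ℝ :=
  if 0 ≤ x then (1 / 2) * Real.exp (-(ε₀ * x)) else 1 - (1 / 2) * Real.exp (ε₀ * x)

/-- Probability of passing the randomized privacy test from partition `i`. -/
def pt (p : U → U → ℝ) (γ ε₀ : ℝ) (k : ℕ) (D : Finset U) (i : ℕ) (y : U) : ℝ :=
  lapTail ε₀ ((k : ℝ) - ((Cpart p γ D y i).card : ℝ))

/-- Probability of producing `y` from partition `i`. -/
def q (p : U → U → ℝ) (γ ε₀ : ℝ) (k : ℕ) (D : Finset U) (i : ℕ) (y : U) : ℝ :=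
  pt p γ ε₀ k D i y * ∑ s ∈ Cpart p γ D y i, p s y

/-- Probability that the mechanism `F` on input dataset `D` releases `y`. -/
def PF (p : U → U → ℝ) (γ ε₀ : ℝ) (k : ℕ) (D : Finset U) (y : U) : ℝ :=
  (1 / (D.card : ℝ)) *
    ∑ s ∈ D.filter (fun s => 0 < p s y), p s y * pt p γ ε₀ k D (Ipart γ (p s y)) y

lemma lapTail_nonneg {ε₀ : ℝ} (hε : 0 ≤ ε₀) (x : ℝ) : 0 ≤ lapTail ε₀ x := by
  unfold lapTail
  split_ifs with h
  · positivity
  · have : Real.exp (ε₀ * x) ≤ 1 :=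
      Real.exp_le_one_iff.2 (mul_nonpos_of_nonneg_of_nonpos hε (not_le.1 h).le)
    linarith

lemma lapTail_sub_one_le {ε₀ : ℝ} (hε : 0 ≤ ε₀) (x : ℝ) :
    lapTail ε₀ (x - 1) ≤ Real.exp ε₀ * lapTail ε₀ x := by
  unfold lapTail
  have hb : 1 ≤ Real.exp ε₀ := Real.one_le_exp hε
  split_ifs with h1 h2 h2
  · have : Real.exp (-(ε₀ * (x - 1))) = Real.exp ε₀ * Real.exp (-(ε₀ * x)) := by
      rw [← Real.exp_add]; ring_nf
    rw [this]; linarith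
  · linarith
  · have e1 : Real.exp ε₀ * Real.exp (-(ε₀ * x)) = Real.exp (-(ε₀ * (x - 1))) := by
      rw [← Real.exp_add]; ring_nf
    have e2 := Real.add_one_le_exp (-(ε₀ * (x - 1)))
    have e3 := Real.add_one_le_exp (ε₀ * (x - 1))
    linarith
  · have e1 : Real.exp (ε₀ * x) = Real.exp ε₀ * Real.exp (ε₀ * (x - 1)) := by
      rw [← Real.exp_add]; ring_nf
    have ha : Real.exp (ε₀ * x) ≤ 1 :=
      Real.exp_le_one_iff.2 (mul_nonpos_of_nonneg_of_nonpos hε (not_le.1 h2).le)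
    have hw : Real.exp (ε₀ * (x - 1)) ≤ Real.exp (ε₀ * x) :=
      Real.exp_le_exp.2 (by nlinarith)
    have := mul_nonneg (sub_nonneg.2 hb)
      (by linarith : 0 ≤ 2 - Real.exp (ε₀ * x) - Real.exp (ε₀ * (x - 1)))
    nlinarith

lemma lapTail_le_exp {ε₀ x z : ℝ} (hε : 0 ≤ ε₀) (hz : 0 ≤ z) (hzx : z ≤ x) :
    lapTail ε₀ x ≤ Real.exp (-(ε₀ * z)) := by
  rw [lapTail, if_pos (hz.trans hzx)]
  have : Real.exp (-(ε₀ * x)) ≤ Real.exp (-(ε₀ * z)) :=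
    Real.exp_le_exp.2 (neg_le_neg (mul_le_mul_of_nonneg_left hzx hε))
  linarith [Real.exp_pos (-(ε₀ * x))]

/-- Two probabilities with the same partition number differ by a factor of at most `γ`. -/
lemma le_mul_of_Ipart_eq {γ x z : ℝ} (hγ : 1 < γ) (hx : 0 < x) (hx1 : x ≤ 1) (hz : 0 < z)
    (h : Ipart γ z = Ipart γ x) : x ≤ γ * z := by
  have h1 : (Ipart γ x : ℝ) ≤ -Real.logb γ x :=
    Nat.floor_le (neg_nonneg.2 (Real.logb_nonpos hγ hx.le hx1))
  have h2 : -Real.logb γ z < (Ipart γ z : ℝ) + 1 := Nat.lt_floor_add_one _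
  rw [h] at h2
  have hγ0 : 0 < γ := one_pos.trans hγ
  rw [← Real.logb_le_logb hγ hx (mul_pos hγ0 hz), Real.logb_mul hγ0.ne' hz.ne',
    Real.logb_self_eq_one hγ]
  linarith

lemma pt_nonneg (p : U → U → ℝ) (γ : ℝ) {ε₀ : ℝ} (hε : 0 ≤ ε₀) (k : ℕ) (D : Finset U) (i : ℕ)
    (y : U) : 0 ≤ pt p γ ε₀ k D i y :=
  lapTail_nonneg hε _

lemma q_nonneg (p : U → U → ℝ) (γ : ℝ) {ε₀ : ℝ} (hε : 0 ≤ ε₀) (k : ℕ) (D : Finset U) (i : ℕ)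
    (y : U) : 0 ≤ q p γ ε₀ k D i y :=
  mul_nonneg (pt_nonneg p γ hε k D i y)
    (sum_nonneg fun _ hs => (mem_filter.1 hs).2.1.le)

lemma Cpart_insert_of_mem {p : U → U → ℝ} {γ : ℝ} {D : Finset U} {d y : U} {i : ℕ}
    (h : 0 < p d y ∧ Ipart γ (p d y) = i) :
    Cpart p γ (insert d D) y i = insert d (Cpart p γ D y i) := by
  rw [Cpart, filter_insert, if_pos h, Cpart]

lemma Cpart_insert_of_notMem {p : U → U → ℝ} {γ : ℝ} {D : Finset U} {d y : U} {i : ℕ}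
    (h : ¬(0 < p d y ∧ Ipart γ (p d y) = i)) :
    Cpart p γ (insert d D) y i = Cpart p γ D y i := by
  rw [Cpart, filter_insert, if_neg h, Cpart]

/-- Total (unnormalised) probability of releasing `y` from partitions other than `i`. -/
def restSum (p : U → U → ℝ) (γ ε₀ : ℝ) (k : ℕ) (D : Finset U) (i : ℕ) (y : U) : ℝ :=
  ∑ s ∈ D.filter (fun s => 0 < p s y ∧ ¬Ipart γ (p s y) = i),
    p s y * pt p γ ε₀ k D (Ipart γ (p s y)) y

lemma restSum_nonneg (p : U → U → ℝ) (γ : ℝ) {ε₀ : ℝ} (hε : 0 ≤ ε₀) (k : ℕ) (D : Finset U)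
    (i : ℕ) (y : U) : 0 ≤ restSum p γ ε₀ k D i y :=
  sum_nonneg fun _ hs => mul_nonneg (mem_filter.1 hs).2.1.le (pt_nonneg p γ hε k D _ y)

lemma PF_eq_q_add_restSum (p : U → U → ℝ) (γ ε₀ : ℝ) (k : ℕ) (D : Finset U) (i : ℕ) (y : U) :
    PF p γ ε₀ k D y =
      (1 / (D.card : ℝ)) * (q p γ ε₀ k D i y + restSum p γ ε₀ k D i y) := by
  rw [PF, ← sum_filter_add_sum_filter_not _ (fun s => Ipart γ (p s y) = i), filter_filter,
    filter_filter, q, restSum, mul_sum]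
  congr 2
  refine sum_congr rfl fun s hs => ?_
  rw [(mem_filter.1 hs).2.2, mul_comm]

lemma restSum_insert (p : U → U → ℝ) (γ ε₀ : ℝ) (k : ℕ) (D : Finset U) (d y : U) :
    restSum p γ ε₀ k (insert d D) (Ipart γ (p d y)) y =
      restSum p γ ε₀ k D (Ipart γ (p d y)) y := by
  rw [restSum, restSum, filter_insert, if_neg (fun h => h.2 rfl)]
  refine sum_congr rfl fun s hs => ?_
  rw [pt, pt, Cpart_insert_of_notMem fun h => (mem_filter.1 hs).2.2 h.2.symm]

lemma q_insert_of_not_pos {p : U → U → ℝ} {γ ε₀ : ℝ} {k : ℕ} {D : Finset U} {d y : U} (i : ℕ)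
    (h : ¬0 < p d y) : q p γ ε₀ k (insert d D) i y = q p γ ε₀ k D i y := by
  rw [q, q, pt, pt, Cpart_insert_of_notMem fun h' => h h'.1]

/-- If the partition of `d` in `insert d D` has at most `t` elements, the test rarely passes. -/
lemma q_insert_le_of_card_lt {p : U → U → ℝ} {γ ε₀ : ℝ} (hε : 0 ≤ ε₀) {k t : ℕ} (htk : t ≤ k)
    {D : Finset U} {d y : U} (hd : d ∉ D) (hpos : 0 < p d y)
    (hc : (Cpart p γ D y (Ipart γ (p d y))).card < t) :
    q p γ ε₀ k (insert d D) (Ipart γ (p d y)) y ≤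
      Real.exp (-(ε₀ * ((k : ℝ) - t))) *
        ∑ s ∈ Cpart p γ (insert d D) y (Ipart γ (p d y)), p s y := by
  refine mul_le_mul_of_nonneg_right ?_ (sum_nonneg fun _ hs => (mem_filter.1 hs).2.1.le)
  refine lapTail_le_exp hε (sub_nonneg.2 (Nat.cast_le.2 htk)) (sub_le_sub_left ?_ _)
  have hdC : d ∉ Cpart p γ D y (Ipart γ (p d y)) := fun h => hd (mem_filter.1 h).1
  rw [Cpart_insert_of_mem ⟨hpos, rfl⟩, card_insert_of_notMem hdC]
  exact_mod_cast hc

/-- If the partition of `d` in `D` has at least `t` elements, inserting `d` changes the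
probability of releasing `y` from it by a bounded factor. -/
lemma q_insert_le_of_le_card {p : U → U → ℝ} {γ ε₀ : ℝ} (hγ : 1 < γ) (hε : 0 ≤ ε₀) (k : ℕ)
    {t : ℕ} (ht : 1 ≤ t) {D : Finset U} {d y : U} (hd : d ∉ D) (hpos : 0 < p d y)
    (hp1 : p d y ≤ 1) (hc : t ≤ (Cpart p γ D y (Ipart γ (p d y))).card) :
    q p γ ε₀ k (insert d D) (Ipart γ (p d y)) y ≤
      Real.exp ε₀ * (1 + γ / t) * q p γ ε₀ k D (Ipart γ (p d y)) y := by
  have hdC : d ∉ Cpart p γ D y (Ipart γ (p d y)) := fun h => hd (mem_filter.1 h).1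
  rw [q, q, pt, pt, Cpart_insert_of_mem ⟨hpos, rfl⟩, card_insert_of_notMem hdC,
    sum_insert hdC]
  set C := Cpart p γ D y (Ipart γ (p d y))
  have ht0 : (0 : ℝ) < t := by exact_mod_cast ht
  have hsum : (t : ℝ) * p d y ≤ γ * ∑ s ∈ C, p s y := by
    calc (t : ℝ) * p d y ≤ C.card * p d y := by gcongr
      _ = ∑ _s ∈ C, p d y := by rw [sum_const, nsmul_eq_mul]
      _ ≤ ∑ s ∈ C, γ * p s y := sum_le_sum fun s hs =>
          le_mul_of_Ipart_eq hγ hpos hp1 (mem_filter.1 hs).2.1 (mem_filter.1 hs).2.2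
      _ = γ * ∑ s ∈ C, p s y := (mul_sum _ _ _).symm
  have hsum' : p d y + ∑ s ∈ C, p s y ≤ (1 + γ / t) * ∑ s ∈ C, p s y := by
    have : p d y ≤ γ / t * ∑ s ∈ C, p s y := by
      rw [div_mul_eq_mul_div, le_div_iff₀ ht0]; linarith
    linarith
  have hlap : lapTail ε₀ ((k : ℝ) - ((C.card + 1 : ℕ) : ℝ)) ≤
      Real.exp ε₀ * lapTail ε₀ ((k : ℝ) - C.card) := by
    have := lapTail_sub_one_le hε ((k : ℝ) - C.card)
    rwa [sub_sub, ← Nat.cast_add_one] at this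
  have hS : 0 ≤ ∑ s ∈ C, p s y := sum_nonneg fun _ hs => (mem_filter.1 hs).2.1.le
  calc _ ≤ (Real.exp ε₀ * lapTail ε₀ ((k : ℝ) - C.card)) * ((1 + γ / t) * ∑ s ∈ C, p s y) :=
        mul_le_mul hlap hsum' (by positivity)
          (mul_nonneg (Real.exp_pos _).le (lapTail_nonneg hε _))
    _ = _ := by ring

/-- Second half of the core differential-privacy lemma:
`Pr[F(D') = y] ≤ e^ε · Pr[F(D) = y] + δ(D', d', y)` for `ε = ε₀ + ln(1 + γ/t)`, where
`δ(D', d', y) = e^{-ε₀(k-t)} · (1/|D'|) · Σ_{s ∈ C_{I_{d'}(y)}(D',y)} p s y` if `p d' y > 0`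
and `δ(D', d', y) = 0` otherwise. -/
theorem PF_insert_le_exp_mul_PF_add_delta (γ ε₀ : ℝ) (hγ : 1 < γ) (hε : 0 < ε₀)
    (k : ℕ) (hk : 1 ≤ k) (t : ℕ) (ht : 1 ≤ t) (htk : t < k)
    (ε : ℝ) (hεdef : ε = ε₀ + Real.log (1 + γ / (t : ℝ)))
    (p : U → U → ℝ) (hp : ∀ d y, 0 ≤ p d y ∧ p d y ≤ 1)
    (D : Finset U) (hD : k ≤ D.card)
    (d' : U) (hd' : d' ∉ D) (D' : Finset U) (hD' : D' = insert d' D) (y : U) :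
    PF p γ ε₀ k D' y ≤ Real.exp ε * PF p γ ε₀ k D y +
      (if 0 < p d' y then
        Real.exp (-(ε₀ * ((k : ℝ) - t))) * (1 / (D'.card : ℝ)) *
          ∑ s ∈ Cpart p γ D' y (Ipart γ (p d' y)), p s y
       else 0) := by
  subst hD'
  have ht0 : (0 : ℝ) < t := by exact_mod_cast ht
  have hγt : 0 < γ / (t : ℝ) := div_pos (one_pos.trans hγ) ht0
  have hexp : Real.exp ε = Real.exp ε₀ * (1 + γ / t) := by
    rw [hεdef, Real.exp_add, Real.exp_log (by linarith)]
  have hexp1 : 1 ≤ Real.exp ε := by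
    rw [hexp]
    exact one_le_mul_of_one_le_of_one_le (Real.one_le_exp hε.le) (by linarith)
  have hn : (0 : ℝ) < D.card := by exact_mod_cast (hk.trans hD)
  have hcard : 1 / ((insert d' D).card : ℝ) ≤ 1 / (D.card : ℝ) :=
    one_div_le_one_div_of_le hn (by exact_mod_cast card_le_card (subset_insert d' D))
  have hm : 0 ≤ 1 / ((insert d' D).card : ℝ) := by positivity
  rw [PF_eq_q_add_restSum p γ ε₀ k (insert d' D) (Ipart γ (p d' y)),
    PF_eq_q_add_restSum p γ ε₀ k D (Ipart γ (p d' y)), restSum_insert]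
  have hR := restSum_nonneg p γ hε.le k D (Ipart γ (p d' y)) y
  have hq := q_nonneg p γ hε.le k D (Ipart γ (p d' y)) y
  set R := restSum p γ ε₀ k D (Ipart γ (p d' y)) y
  set Q := q p γ ε₀ k D (Ipart γ (p d' y)) y
  have hR' : R ≤ Real.exp ε * R := le_mul_of_one_le_left hR hexp1
  have hQ' : Q ≤ Real.exp ε * Q := le_mul_of_one_le_left hq hexp1
  obtain ⟨δ, hδ, hsum⟩ : ∃ δ : ℝ, (if 0 < p d' y then
        Real.exp (-(ε₀ * ((k : ℝ) - t))) * (1 / ((insert d' D).card : ℝ)) *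
          ∑ s ∈ Cpart p γ (insert d' D) y (Ipart γ (p d' y)), p s y
       else 0) = 1 / ((insert d' D).card : ℝ) * δ ∧
      q p γ ε₀ k (insert d' D) (Ipart γ (p d' y)) y ≤ Real.exp ε * Q + δ := by
    by_cases hpos : 0 < p d' y
    · refine ⟨Real.exp (-(ε₀ * ((k : ℝ) - t))) *
          ∑ s ∈ Cpart p γ (insert d' D) y (Ipart γ (p d' y)), p s y,
        by rw [if_pos hpos]; ring, ?_⟩
      rcases lt_or_ge (Cpart p γ D y (Ipart γ (p d' y))).card t with hc | hc
      · have := q_insert_le_of_card_lt hε.le htk.le hd' hpos hc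
        linarith
      · have := q_insert_le_of_le_card hγ hε.le k ht hd' hpos (hp d' y).2 hc
        rw [← hexp] at this
        have hδ : 0 ≤ Real.exp (-(ε₀ * ((k : ℝ) - t))) *
            ∑ s ∈ Cpart p γ (insert d' D) y (Ipart γ (p d' y)), p s y :=
          mul_nonneg (Real.exp_pos _).le (sum_nonneg fun _ hs => (mem_filter.1 hs).2.1.le)
        linarith
    · refine ⟨0, by rw [if_neg hpos]; ring, ?_⟩
      rw [q_insert_of_not_pos _ hpos]
      linarith
  rw [hδ]
  calc _ ≤ 1 / ((insert d' D).card : ℝ) * (Real.exp ε * (Q + R) + δ) :=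
        mul_le_mul_of_nonneg_left (by linarith) hm
    _ = 1 / ((insert d' D).card : ℝ) * (Real.exp ε * (Q + R)) +
          1 / ((insert d' D).card : ℝ) * δ := mul_add _ _ _
    _ ≤ 1 / (D.card : ℝ) * (Real.exp ε * (Q + R)) +
          1 / ((insert d' D).card : ℝ) * δ := by gcongr
    _ = _ := by ring

end PD
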